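/- Convergence of Prox-SVRG (Theorem 1). Let P(y) = F(y) + G(y) on ℝ^n, where F(y) = Σ_{t=0}^{N} F_t(y), each F_t : ℝ^n → ℝ is convex and differentiable with L_t-Lipschitz continuous gradient, F is strongly convex with parameter σ_F > 0, and G : ℝ^n → ℝ is convex and continuous; let y* be the unique minimizer of P. Let Π = (π_0,…,π_N) be a probability distribution on {0,…,N} with every π_t > 0, and let L_Π = max_t L_t/π_t. Fix a step size τ with 0 < τ < 1/(4 L_Π) and an integer T ≥ 1 large enough that ρ := 1/(τ σ_F T (1 − 4τL_Π)) + 4τL_Π(T+1)/(T(1 − 4τL_Π)) < 1. Given an initial point ỹ⁰ ∈ ℝ^n and an i.i.d. sequence of random indices drawn from {0,…,N} with distribution Π, define for each stage s = 1,…,s̄: ỹ = ỹ^{s−1}, β̃ = ∇F(ỹ), y⁰ = ỹ; for k = 1,…,T, with i the next random index, β^k = β̃ + (∇F_i(y^{k−1}) − ∇F_i(ỹ))/π_i and y^k = prox_{τG}(y^{k−1} − τ β^k); and ỹ^s = (1/T) Σ_{k=1}^{T} y^k. Then for every s̄ ≥ 1, E[P(ỹ^{s̄})] − P(y*) ≤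 ρ^{s̄} (P(ỹ⁰) − P(y*)), where the expectation is over the (finitely many) index draws, i.e. the sum over all index sequences ω : {1,…,s̄T} → {0,…,N} of (Π_j π_{ω(j)}) · P(ỹ^{s̄}(ω)). -/

import Mathlib

open scoped RealInnerProductSpace
open Finset

noncomputable section

/-- One pass of the inner loop of Prox-SVRG: starting from `ỹ`, using the gradient maps
`F'`, the probabilities `π`, the proximal map `prox` of `τ G`, the step size `τ`, and the
sequence of drawn indices `idx` (the `(k+1)`-st drawn index is `idx k`), this is the
iterate `y^k`:  `y^0 = ỹ` and
`y^{k+1} = prox (y^k − τ (∇F(ỹ) + (∇F_i(y^k) − ∇F_i(ỹ))/π_i))` with `i = idx k`. -/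
def svrgInner {n N : ℕ}
    (F' : Fin (N + 1) → EuclideanSpace ℝ (Fin n) → EuclideanSpace ℝ (Fin n))
    (π : Fin (N + 1) → ℝ)
    (prox : EuclideanSpace ℝ (Fin n) → EuclideanSpace ℝ (Fin n)) (τ : ℝ)
    (idx : ℕ → Fin (N + 1)) (ytilde : EuclideanSpace ℝ (Fin n)) :
    ℕ → EuclideanSpace ℝ (Fin n)
  | 0 => ytilde
  | k + 1 =>
    let y := svrgInner F' π prox τ idx ytilde k
    let i := idx k
    prox (y - τ • ((∑ t, F' t ytilde) + (π i)⁻¹ • (F' i y - F' i ytilde)))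

/-- The outer (stage) iterates `ỹ^s` of Prox-SVRG: `ỹ^0` is the initial point and
`ỹ^{s+1} = (1/T) Σ_{k=1}^{T} y^k`, where the inner loop is started at `ỹ^s` and consumes
the draws number `sT, …, sT + T − 1`. -/
def svrgOuter {n N : ℕ}
    (F' : Fin (N + 1) → EuclideanSpace ℝ (Fin n) → EuclideanSpace ℝ (Fin n))
    (π : Fin (N + 1) → ℝ)
    (prox : EuclideanSpace ℝ (Fin n) → EuclideanSpace ℝ (Fin n)) (τ : ℝ)
    (idx : ℕ → Fin (N + 1)) (T : ℕ) (y0 : EuclideanSpace ℝ (Fin n)) :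
    ℕ → EuclideanSpace ℝ (Fin n)
  | 0 => y0
  | s + 1 =>
    (T : ℝ)⁻¹ • ∑ k ∈ Finset.range T,
      svrgInner F' π prox τ (fun j => idx (s * T + j))
        (svrgOuter F' π prox τ idx T y0 s) (k + 1)

/-- Extension of a finite index sequence `v : Fin M → Fin (N+1)` to `ℕ`. -/
def extendIdx {N : ℕ} (M : ℕ) (v : Fin M → Fin (N + 1)) : ℕ → Fin (N + 1) :=
  fun j => if h : j < M then v ⟨j, h⟩ else 0

/-- `h` is strongly convex with parameter `σ`. -/
def StronglyConvexWith {E : Type*} [NormedAddCommGroup E] [NormedSpace ℝ E]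
    (σ : ℝ) (h : E → ℝ) : Prop :=
  ∀ x y : E, ∀ l : ℝ, 0 ≤ l → l ≤ 1 →
    h (l • x + (1 - l) • y) ≤ l * h x + (1 - l) * h y - σ / 2 * (l * (1 - l) * ‖x - y‖ ^ 2)

section ConvexAnalysis

variable {E : Type*} [NormedAddCommGroup E] [InnerProductSpace ℝ E]

lemma nonneg_of_forall_mul_add_sq_mul_nonneg {a b : ℝ}
    (h : ∀ t : ℝ, 0 < t → t ≤ 1 → 0 ≤ t * a + t ^ 2 * b) : 0 ≤ a := by
  by_contra! ha
  have hc : 0 < |b| + |a| + 1 := by positivity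
  have ht : 0 < |a| / (|b| + |a| + 1) := div_pos (abs_pos.2 ha.ne) hc
  have ht1 : |a| / (|b| + |a| + 1) ≤ 1 := by
    rw [div_le_one hc]
    linarith [abs_nonneg b]
  set t := |a| / (|b| + |a| + 1) with htdef
  have h1 : 0 ≤ t * (a + t * b) := by linarith [h t ht ht1]
  have h2 : 0 ≤ a + t * b := nonneg_of_mul_nonneg_right h1 ht
  have h3 : t * (|b| + |a| + 1) = |a| := by
    rw [htdef]
    field_simp
  have h4 : t * b ≤ t * |b| := mul_le_mul_of_nonneg_left (le_abs_self b) ht.le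
  have h5 : 0 ≤ t * |a| := by positivity
  rw [abs_of_neg ha] at h3 h5
  linarith

lemma HasGradientAt.hasDerivAt_comp_add_smul [CompleteSpace E] {f : E → ℝ} {g x d : E} {t : ℝ}
    (h : HasGradientAt f g (x + t • d)) :
    HasDerivAt (fun s : ℝ => f (x + s • d)) ⟪g, d⟫ t := by
  have h1 : HasDerivAt (fun s : ℝ => x + s • d) d t := by
    simpa using ((hasDerivAt_id t).smul_const d).const_add x
  have h2 := h.hasFDerivAt.comp_hasDerivAt t h1
  rwa [InnerProductSpace.toDual_apply_apply] at h2

lemma ConvexOn.add_inner_gradient_le [CompleteSpace E] {f : E → ℝ}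
    (hf : ConvexOn ℝ Set.univ f) {x g : E} (hg : HasGradientAt f g x) (y : E) :
    f x + ⟪g, y - x⟫ ≤ f y := by
  have hline : ConvexOn ℝ Set.univ (fun s : ℝ => f (x + s • (y - x))) := by
    have := hf.comp_affineMap (AffineMap.lineMap x y : ℝ →ᵃ[ℝ] E)
    simpa [Function.comp_def, AffineMap.lineMap_apply, add_comm] using this
  have hderiv : HasDerivAt (fun s : ℝ => f (x + s • (y - x))) ⟪g, y - x⟫ 0 :=
    HasGradientAt.hasDerivAt_comp_add_smul (by simpa using hg)
  have := hline.le_slope_of_hasDerivAt (Set.mem_univ 0) (Set.mem_univ 1) one_pos hderiv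
  simp [slope_def_field] at this
  linarith

/-- The descent lemma for functions with Lipschitz gradient. -/
lemma le_add_inner_gradient_add_sq [CompleteSpace E] {f : E → ℝ} {f' : E → E} {K : ℝ}
    (hf : ∀ x, HasGradientAt f (f' x) x) (hlip : ∀ x y, ‖f' x - f' y‖ ≤ K * ‖x - y‖) (x y : E) :
    f y ≤ f x + ⟪f' x, y - x⟫ + K / 2 * ‖y - x‖ ^ 2 := by
  set d := y - x with hd
  have hderiv : ∀ t : ℝ, HasDerivAt
      (fun s : ℝ => f (x + s • d) - (s * ⟪f' x, d⟫ + K / 2 * ‖d‖ ^ 2 * s ^ 2))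
      (⟪f' (x + t • d), d⟫ - (1 * ⟪f' x, d⟫ + K / 2 * ‖d‖ ^ 2 * ((2 : ℕ) * t ^ 1))) t := fun t =>
    (HasGradientAt.hasDerivAt_comp_add_smul (hf _)).sub
      (((hasDerivAt_id t).mul_const _).add ((hasDerivAt_pow 2 t).const_mul _))
  have hanti : AntitoneOn
      (fun s : ℝ => f (x + s • d) - (s * ⟪f' x, d⟫ + K / 2 * ‖d‖ ^ 2 * s ^ 2)) (Set.Icc 0 1) := by
    apply antitoneOn_of_deriv_nonpos (convex_Icc 0 1)
    · exact fun t _ => (hderiv t).continuousAt.continuousWithinAt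
    · exact fun t _ => (hderiv t).differentiableAt.differentiableWithinAt
    · intro t ht
      rw [interior_Icc] at ht
      rw [(hderiv t).deriv]
      have h1 : ⟪f' (x + t • d) - f' x, d⟫ ≤ K * (t * ‖d‖) * ‖d‖ := by
        refine (real_inner_le_norm _ _).trans (mul_le_mul_of_nonneg_right ?_ (norm_nonneg d))
        have := hlip (x + t • d) x
        rwa [add_sub_cancel_left, norm_smul, Real.norm_of_nonneg ht.1.le] at this
      rw [inner_sub_left] at h1
      push_cast
      linarith
  have := hanti (Set.left_mem_Icc.2 zero_le_one) (Set.right_mem_Icc.2 zero_le_one) zero_le_one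
  simp [hd] at this
  linarith

/-- Co-coercivity of the gradient of a smooth convex function. -/
lemma ConvexOn.norm_gradient_sub_sq_le [CompleteSpace E] {f : E → ℝ} {f' : E → E} {K : ℝ}
    (hK : 0 < K) (hconv : ConvexOn ℝ Set.univ f) (hf : ∀ x, HasGradientAt f (f' x) x)
    (hlip : ∀ x y, ‖f' x - f' y‖ ≤ K * ‖x - y‖) (x y : E) :
    ‖f' x - f' y‖ ^ 2 ≤ 2 * K * (f x - f y - ⟪f' y, x - y⟫) := by
  set d := f' x - f' y with hd
  have h1 := le_add_inner_gradient_add_sq hf hlip x (x - K⁻¹ • d)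
  have h2 := hconv.add_inner_gradient_le (hf y) (x - K⁻¹ • d)
  have e1 : x - K⁻¹ • d - x = -(K⁻¹ • d) := by abel
  have e2 : x - K⁻¹ • d - y = (x - y) - K⁻¹ • d := by abel
  have e3 : ⟪f' x, d⟫ - ⟪f' y, d⟫ = ‖d‖ ^ 2 := by
    rw [← inner_sub_left, ← hd, real_inner_self_eq_norm_sq]
  rw [e1, norm_neg, norm_smul, inner_neg_right, inner_smul_right,
    Real.norm_of_nonneg (inv_nonneg.2 hK.le)] at h1
  rw [e2, inner_sub_right, inner_smul_right] at h2
  have h3 : K / 2 * (K⁻¹ * ‖d‖) ^ 2 = K⁻¹ * ‖d‖ ^ 2 / 2 := by field_simp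
  have h4 : K⁻¹ * ‖d‖ ^ 2 / 2 ≤ f x - f y - ⟪f' y, x - y⟫ := by
    rw [h3] at h1
    have : K⁻¹ * ⟪f' x, d⟫ - K⁻¹ * ⟪f' y, d⟫ = K⁻¹ * ‖d‖ ^ 2 := by rw [← mul_sub, e3]
    linarith
  have h5 : 2 * K * (K⁻¹ * ‖d‖ ^ 2 / 2) = ‖d‖ ^ 2 := by field_simp
  calc ‖d‖ ^ 2 = 2 * K * (K⁻¹ * ‖d‖ ^ 2 / 2) := h5.symm
    _ ≤ _ := by gcongr

lemma ConvexOn.map_add_smul_sub_le {G : E → ℝ} (hG : ConvexOn ℝ Set.univ G) (x y : E) {t : ℝ}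
    (h0 : 0 ≤ t) (h1 : t ≤ 1) : G (x + t • (y - x)) ≤ G x + t * (G y - G x) := by
  have := hG.2 (Set.mem_univ x) (Set.mem_univ y) (sub_nonneg.2 h1) h0 (by ring)
  have e : x + t • (y - x) = (1 - t) • x + t • y := by module
  rw [e]
  simp only [smul_eq_mul] at this
  linarith

/-- First-order optimality for the minimizer `p` of `(1/2)‖· - x‖² + τ G`. -/
lemma ConvexOn.inner_sub_prox_le {G : E → ℝ} (hG : ConvexOn ℝ Set.univ G) {τ : ℝ} (hτ : 0 ≤ τ)
    {x p : E} (hp : ∀ y, (1 / 2) * ‖p - x‖ ^ 2 + τ * G p ≤ (1 / 2) * ‖y - x‖ ^ 2 + τ * G y)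
    (y : E) : ⟪x - p, y - p⟫ ≤ τ * (G y - G p) := by
  suffices 0 ≤ τ * (G y - G p) - ⟪x - p, y - p⟫ by linarith
  refine nonneg_of_forall_mul_add_sq_mul_nonneg (b := ‖y - p‖ ^ 2 / 2) fun t ht0 ht1 => ?_
  have h1 := hp (p + t • (y - p))
  have h2 := mul_le_mul_of_nonneg_left (hG.map_add_smul_sub_le p y ht0.le ht1) hτ
  have e : p + t • (y - p) - x = t • (y - p) - (x - p) := by abel
  rw [e, norm_sub_sq_real (t • (y - p)), norm_smul, mul_pow, inner_smul_left,
    Real.norm_of_nonneg ht0.le, real_inner_comm, norm_sub_rev p x] at h1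
  simp only [conj_trivial] at h1
  linarith

lemma norm_sub_le_of_inner_sub_prox_le {G : E → ℝ} {τ : ℝ} {x y p q : E}
    (hp : ∀ z, ⟪x - p, z - p⟫ ≤ τ * (G z - G p)) (hq : ∀ z, ⟪y - q, z - q⟫ ≤ τ * (G z - G q)) :
    ‖p - q‖ ≤ ‖x - y‖ := by
  have h1 := hp q
  have h2 := hq p
  have e : ⟪x - p, q - p⟫ + ⟪y - q, p - q⟫ = ‖p - q‖ ^ 2 - ⟪x - y, p - q⟫ := by
    rw [← real_inner_self_eq_norm_sq]
    simp only [inner_sub_left, inner_sub_right]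
    ring
  have h3 : ‖p - q‖ * ‖p - q‖ ≤ ‖x - y‖ * ‖p - q‖ := by
    linarith [real_inner_le_norm (x - y) (p - q)]
  rcases (norm_nonneg (p - q)).eq_or_lt with h | h
  · rw [← h]
    positivity
  · exact le_of_mul_le_mul_right h3 h

/-- First-order optimality for a minimizer of the sum of a smooth and a convex function. -/
lemma ConvexOn.neg_inner_gradient_le_of_isMin [CompleteSpace E] {f G : E → ℝ} {f' : E → E} {K : ℝ}
    (hf : ∀ x, HasGradientAt f (f' x) x) (hlip : ∀ x y, ‖f' x - f' y‖ ≤ K * ‖x - y‖)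
    (hG : ConvexOn ℝ Set.univ G) {z : E} (hz : ∀ y, f z + G z ≤ f y + G y) (y : E) :
    -⟪f' z, y - z⟫ ≤ G y - G z := by
  suffices 0 ≤ G y - G z + ⟪f' z, y - z⟫ by linarith
  refine nonneg_of_forall_mul_add_sq_mul_nonneg (b := K / 2 * ‖y - z‖ ^ 2) fun t ht0 ht1 => ?_
  have h1 := hz (z + t • (y - z))
  have h2 := hG.map_add_smul_sub_le z y ht0.le ht1
  have h3 := le_add_inner_gradient_add_sq hf hlip z (z + t • (y - z))
  rw [add_sub_cancel_left, inner_smul_right, norm_smul, mul_pow, Real.norm_of_nonneg ht0.le] at h3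
  linarith

/-- Quadratic growth of a strongly convex plus convex function at its minimizer. -/
lemma StronglyConvexWith.norm_sub_sq_le {f G : E → ℝ} {σ : ℝ}
    (hf : StronglyConvexWith σ f) (hG : ConvexOn ℝ Set.univ G)
    {z : E} (hz : ∀ y, f z + G z ≤ f y + G y) (y : E) :
    σ / 2 * ‖y - z‖ ^ 2 ≤ f y + G y - (f z + G z) := by
  suffices 0 ≤ f y + G y - (f z + G z) - σ / 2 * ‖y - z‖ ^ 2 by linarith
  refine nonneg_of_forall_mul_add_sq_mul_nonneg (b := σ / 2 * ‖y - z‖ ^ 2) fun t ht0 ht1 => ?_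
  have h1 := hz (z + t • (y - z))
  have h2 := hG.map_add_smul_sub_le z y ht0.le ht1
  have h3 := hf y z t ht0.le ht1
  have e : t • y + (1 - t) • z = z + t • (y - z) := by module
  rw [e] at h3
  linarith

/-- One proximal step with an inexact gradient `v`, compared with the exact step. -/
lemma prox_step_le [CompleteSpace E] {f G : E → ℝ} {f' : E → E} {K τ : ℝ}
    (hconv : ConvexOn ℝ Set.univ f) (hf : ∀ x, HasGradientAt f (f' x) x)
    (hlip : ∀ x y, ‖f' x - f' y‖ ≤ K * ‖x - y‖) (hτ : 0 ≤ τ) (hτK : τ * K ≤ 1)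
    {y v p q : E} (hp : ∀ z, ⟪y - τ • v - p, z - p⟫ ≤ τ * (G z - G p))
    (hq : ∀ z, ⟪y - τ • f' y - q, z - q⟫ ≤ τ * (G z - G q)) (z : E) :
    ‖p - z‖ ^ 2 + 2 * τ * (f p + G p - (f z + G z)) ≤
      ‖y - z‖ ^ 2 + 2 * τ ^ 2 * ‖v - f' y‖ ^ 2 + 2 * τ * ⟪v - f' y, z - q⟫ := by
  have hpq : ‖q - p‖ ≤ τ * ‖v - f' y‖ := by
    refine (norm_sub_le_of_inner_sub_prox_le hq hp).trans_eq ?_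
    rw [← norm_smul_of_nonneg hτ]
    congr 1
    module
  have h1 : ⟪v - f' y, q - p⟫ ≤ τ * ‖v - f' y‖ ^ 2 := by
    refine (real_inner_le_norm _ _).trans ?_
    nlinarith [mul_le_mul_of_nonneg_left hpq (norm_nonneg (v - f' y))]
  have h2 := hp z
  have h3 := le_add_inner_gradient_add_sq hf hlip y p
  have h4 := hconv.add_inner_gradient_le (hf y) z
  have e1 : ⟪y - τ • v - p, z - p⟫ = ⟪y - p, z - p⟫ - τ * ⟪v, z - p⟫ := by
    rw [← real_inner_smul_left, ← inner_sub_left]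
    congr 1
    abel
  have e2 : ‖y - z‖ ^ 2 = ‖p - y‖ ^ 2 + ‖p - z‖ ^ 2 - 2 * ⟪y - p, z - p⟫ := by
    rw [show y - z = (y - p) - (z - p) by abel, norm_sub_sq_real, norm_sub_rev p y,
      norm_sub_rev p z]
    ring
  have e3 : ⟪v, z - p⟫ = ⟪v - f' y, z - q⟫ + ⟪v - f' y, q - p⟫ + ⟪f' y, z - y⟫ - ⟪f' y, p - y⟫ := by
    simp only [inner_sub_left, inner_sub_right]
    ring
  have h5 : (1 - τ * K) * ‖p - y‖ ^ 2 ≥ 0 := mul_nonneg (by linarith) (sq_nonneg _)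
  have h6 : τ * (f p - f z) ≤ τ * (⟪f' y, p - y⟫ + K / 2 * ‖p - y‖ ^ 2 - ⟪f' y, z - y⟫) :=
    mul_le_mul_of_nonneg_left (by linarith) hτ
  have h7 := mul_le_mul_of_nonneg_left h1 hτ
  rw [e1, e3] at h2
  rw [e2]
  nlinarith

end ConvexAnalysis

lemma norm_sum_sub_sum_le {E ι : Type*} [NormedAddCommGroup E] [Fintype ι] {F' : ι → E → E}
    {π : ι → ℝ} {L : ℝ} (hlip : ∀ t x y, ‖F' t x - F' t y‖ ≤ L * π t * ‖x - y‖) (hπsum : ∑ t, π t = 1)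
    (x y : E) : ‖∑ t, F' t x - ∑ t, F' t y‖ ≤ L * ‖x - y‖ := by
  rw [← sum_sub_distrib]
  calc ‖∑ t, (F' t x - F' t y)‖ ≤ ∑ t, L * π t * ‖x - y‖ :=
        norm_sum_le_of_le _ fun t _ => hlip t x y
    _ = L * ‖x - y‖ := by rw [← sum_mul, ← mul_sum, hπsum, mul_one]

section FiniteSum

variable {E ι : Type*} [NormedAddCommGroup E] [InnerProductSpace ℝ E] [Fintype ι]

lemma hasGradientAt_sum [CompleteSpace E] {F : ι → E → ℝ} {F' : ι → E → E}
    (hF : ∀ t x, HasGradientAt (F t) (F' t x) x) (x : E) :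
    HasGradientAt (fun y => ∑ t, F t y) (∑ t, F' t x) x := by
  rw [hasGradientAt_iff_hasFDerivAt, map_sum]
  exact HasFDerivAt.fun_sum fun t _ => (hF t x).hasFDerivAt

lemma convexOn_univ_sum {F : ι → E → ℝ} (hF : ∀ t, ConvexOn ℝ Set.univ (F t)) :
    ConvexOn ℝ Set.univ (fun y => ∑ t, F t y) := by
  refine ⟨convex_univ, fun x _ y _ a b ha hb hab => ?_⟩
  simp only [smul_eq_mul, mul_sum, ← sum_add_distrib]
  exact sum_le_sum fun t _ => (hF t).2 (Set.mem_univ x) (Set.mem_univ y) ha hb hab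

variable {F : ι → E → ℝ} {F' : ι → E → E} {π : ι → ℝ} {L : ℝ}

lemma sum_inv_mul_norm_gradient_sub_sq_le [CompleteSpace E] (hL : 0 < L) (hπpos : ∀ t, 0 < π t)
    (hπsum : ∑ t, π t = 1) (hconv : ∀ t, ConvexOn ℝ Set.univ (F t))
    (hF : ∀ t x, HasGradientAt (F t) (F' t x) x)
    (hlip : ∀ t x y, ‖F' t x - F' t y‖ ≤ L * π t * ‖x - y‖)
    {G : E → ℝ} (hG : ConvexOn ℝ Set.univ G) {z : E}
    (hz : ∀ y, (∑ t, F t z) + G z ≤ (∑ t, F t y) + G y) (y : E) :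
    ∑ t, (π t)⁻¹ * ‖F' t y - F' t z‖ ^ 2 ≤
      2 * L * ((∑ t, F t y) + G y - ((∑ t, F t z) + G z)) := by
  have h1 : ∀ t, (π t)⁻¹ * ‖F' t y - F' t z‖ ^ 2 ≤
      2 * L * (F t y - F t z - ⟪F' t z, y - z⟫) := fun t => by
    have := (hconv t).norm_gradient_sub_sq_le (mul_pos hL (hπpos t)) (hF t) (hlip t) y z
    rw [inv_mul_le_iff₀ (hπpos t)]
    linarith
  have h2 := ConvexOn.neg_inner_gradient_le_of_isMin (hasGradientAt_sum hF)
    (norm_sum_sub_sum_le hlip hπsum) hG hz y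
  calc _ ≤ ∑ t, 2 * L * (F t y - F t z - ⟪F' t z, y - z⟫) := sum_le_sum fun t _ => h1 t
    _ = 2 * L * (∑ t, F t y - ∑ t, F t z - ⟪∑ t, F' t z, y - z⟫) := by
      rw [← mul_sum, sum_sub_distrib, sum_sub_distrib, sum_inner]
    _ ≤ _ := mul_le_mul_of_nonneg_left (by linarith) (by positivity)

/-- The variance of a random vector is at most its second moment. -/
lemma sum_mul_norm_sub_mean_sq_le (hπsum : ∑ t, π t = 1) {ξ : ι → E} {m : E}
    (hm : ∑ t, π t • ξ t = m) : ∑ t, π t * ‖ξ t - m‖ ^ 2 ≤ ∑ t, π t * ‖ξ t‖ ^ 2 := by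
  have e : ∑ t, π t * ⟪ξ t, m⟫ = ‖m‖ ^ 2 := by
    simp_rw [← real_inner_smul_left]
    rw [← sum_inner, hm, real_inner_self_eq_norm_sq]
  have : ∑ t, π t * ‖ξ t - m‖ ^ 2 = ∑ t, π t * ‖ξ t‖ ^ 2 - ‖m‖ ^ 2 :=
    calc _ = ∑ t, (π t * ‖ξ t‖ ^ 2 - 2 * (π t * ⟪ξ t, m⟫) + π t * ‖m‖ ^ 2) :=
          sum_congr rfl fun t _ => by rw [norm_sub_sq_real]; ring
      _ = _ := by
        rw [sum_add_distrib, sum_sub_distrib, ← mul_sum, e, ← sum_mul, hπsum]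
        ring
  rw [this]
  linarith [sq_nonneg ‖m‖]

lemma sum_smul_inv_smul (hπpos : ∀ t, 0 < π t) (w : ι → E) :
    ∑ t, π t • (π t)⁻¹ • w t = ∑ t, w t :=
  sum_congr rfl fun t _ => smul_inv_smul₀ (hπpos t).ne' (w t)

/-- The variance-reduced gradient estimator has variance controlled by the optimality gaps. -/
lemma sum_mul_norm_svrg_gradient_sub_sq_le [CompleteSpace E] (hL : 0 < L) (hπpos : ∀ t, 0 < π t)
    (hπsum : ∑ t, π t = 1) (hconv : ∀ t, ConvexOn ℝ Set.univ (F t))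
    (hF : ∀ t x, HasGradientAt (F t) (F' t x) x)
    (hlip : ∀ t x y, ‖F' t x - F' t y‖ ≤ L * π t * ‖x - y‖)
    {G : E → ℝ} (hG : ConvexOn ℝ Set.univ G) {z : E}
    (hz : ∀ y, (∑ t, F t z) + G z ≤ (∑ t, F t y) + G y) (y w : E) :
    ∑ i, π i * ‖(∑ t, F' t w) + (π i)⁻¹ • (F' i y - F' i w) - ∑ t, F' t y‖ ^ 2 ≤
      4 * L * (((∑ t, F t y) + G y - ((∑ t, F t z) + G z)) +
        ((∑ t, F t w) + G w - ((∑ t, F t z) + G z))) := by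
  have hm : ∑ i, π i • (π i)⁻¹ • (F' i y - F' i w) = ∑ t, F' t y - ∑ t, F' t w := by
    rw [sum_smul_inv_smul hπpos, sum_sub_distrib]
  have hy := sum_inv_mul_norm_gradient_sub_sq_le hL hπpos hπsum hconv hF hlip hG hz y
  have hw := sum_inv_mul_norm_gradient_sub_sq_le hL hπpos hπsum hconv hF hlip hG hz w
  have hpt : ∀ i, π i * ‖(π i)⁻¹ • (F' i y - F' i w)‖ ^ 2 ≤
      2 * ((π i)⁻¹ * ‖F' i y - F' i z‖ ^ 2) + 2 * ((π i)⁻¹ * ‖F' i w - F' i z‖ ^ 2) := fun i => by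
    have hi := hπpos i
    have h1 : ‖F' i y - F' i w‖ ^ 2 ≤ 2 * ‖F' i y - F' i z‖ ^ 2 + 2 * ‖F' i w - F' i z‖ ^ 2 := by
      have h2 := norm_sub_le (F' i y - F' i z) (F' i w - F' i z)
      rw [sub_sub_sub_cancel_right] at h2
      nlinarith [norm_nonneg (F' i y - F' i w), sq_nonneg (‖F' i y - F' i z‖ - ‖F' i w - F' i z‖)]
    have h3 : π i * ‖(π i)⁻¹ • (F' i y - F' i w)‖ ^ 2 = (π i)⁻¹ * ‖F' i y - F' i w‖ ^ 2 := by
      rw [norm_smul, Real.norm_of_nonneg (inv_nonneg.2 hi.le)]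
      field_simp
    rw [h3]
    nlinarith [mul_le_mul_of_nonneg_left h1 (inv_nonneg.2 hi.le)]
  calc _ = ∑ i, π i * ‖(π i)⁻¹ • (F' i y - F' i w) - (∑ t, F' t y - ∑ t, F' t w)‖ ^ 2 :=
        sum_congr rfl fun i _ => by
          rw [show (∑ t, F' t w) + (π i)⁻¹ • (F' i y - F' i w) - ∑ t, F' t y =
            (π i)⁻¹ • (F' i y - F' i w) - (∑ t, F' t y - ∑ t, F' t w) by abel]
    _ ≤ ∑ i, π i * ‖(π i)⁻¹ • (F' i y - F' i w)‖ ^ 2 := sum_mul_norm_sub_mean_sq_le hπsum hm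
    _ ≤ ∑ i, (2 * ((π i)⁻¹ * ‖F' i y - F' i z‖ ^ 2) + 2 * ((π i)⁻¹ * ‖F' i w - F' i z‖ ^ 2)) :=
        sum_le_sum fun i _ => hpt i
    _ ≤ _ := by
        rw [sum_add_distrib, ← mul_sum, ← mul_sum]
        linarith

/-- Expected progress of one inner step of Prox-SVRG towards the minimizer `z`. -/
lemma sum_mul_svrg_step_le [CompleteSpace E] (hL : 0 < L) (hπpos : ∀ t, 0 < π t)
    (hπsum : ∑ t, π t = 1) (hconv : ∀ t, ConvexOn ℝ Set.univ (F t))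
    (hF : ∀ t x, HasGradientAt (F t) (F' t x) x)
    (hlip : ∀ t x y, ‖F' t x - F' t y‖ ≤ L * π t * ‖x - y‖)
    {G : E → ℝ} (hG : ConvexOn ℝ Set.univ G) {z : E}
    (hz : ∀ y, (∑ t, F t z) + G z ≤ (∑ t, F t y) + G y) {τ : ℝ} (hτ : 0 ≤ τ) (hτL : τ * L ≤ 1)
    {prox : E → E} (hprox : ∀ x y, (1 / 2) * ‖prox x - x‖ ^ 2 + τ * G (prox x) ≤
      (1 / 2) * ‖y - x‖ ^ 2 + τ * G y) (y w : E) {p : ι → E}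
    (hp : ∀ i, p i = prox (y - τ • ((∑ t, F' t w) + (π i)⁻¹ • (F' i y - F' i w)))) :
    ∑ i, π i * (‖p i - z‖ ^ 2 + 2 * τ * ((∑ t, F t (p i)) + G (p i) - ((∑ t, F t z) + G z))) ≤
      ‖y - z‖ ^ 2 + 8 * τ ^ 2 * L * (((∑ t, F t y) + G y - ((∑ t, F t z) + G z)) +
        ((∑ t, F t w) + G w - ((∑ t, F t z) + G z))) := by
  set v : ι → E := fun i => (∑ t, F' t w) + (π i)⁻¹ • (F' i y - F' i w) with hv
  set q := prox (y - τ • ∑ t, F' t y) with hq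
  have hstep : ∀ i, ‖p i - z‖ ^ 2 + 2 * τ * ((∑ t, F t (p i)) + G (p i) - ((∑ t, F t z) + G z)) ≤
      ‖y - z‖ ^ 2 + 2 * τ ^ 2 * ‖v i - ∑ t, F' t y‖ ^ 2 +
        2 * τ * ⟪v i - ∑ t, F' t y, z - q⟫ := fun i => by
    rw [hp i]
    exact prox_step_le (convexOn_univ_sum hconv) (hasGradientAt_sum hF)
      (norm_sum_sub_sum_le hlip hπsum) hτ hτL (hG.inner_sub_prox_le hτ (hprox _))
      (hG.inner_sub_prox_le hτ (hprox _)) z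
  have hmean : ∑ i, π i * ⟪v i - ∑ t, F' t y, z - q⟫ = 0 := by
    simp_rw [← real_inner_smul_left]
    rw [← sum_inner]
    have : ∑ i, π i • (v i - ∑ t, F' t y) = 0 := by
      simp_rw [hv, smul_sub, smul_add]
      rw [sum_sub_distrib, sum_add_distrib, ← sum_smul, ← sum_smul, hπsum]
      simp_rw [← smul_sub]
      rw [sum_smul_inv_smul hπpos, sum_sub_distrib]
      simp
    rw [this, inner_zero_left]
  have hvar := sum_mul_norm_svrg_gradient_sub_sq_le hL hπpos hπsum hconv hF hlip hG hz y w
  calc _ ≤ ∑ i, π i * (‖y - z‖ ^ 2 + 2 * τ ^ 2 * ‖v i - ∑ t, F' t y‖ ^ 2 +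
        2 * τ * ⟪v i - ∑ t, F' t y, z - q⟫) :=
        sum_le_sum fun i _ => mul_le_mul_of_nonneg_left (hstep i) (hπpos i).le
    _ = ∑ i, (π i * ‖y - z‖ ^ 2 + 2 * τ ^ 2 * (π i * ‖v i - ∑ t, F' t y‖ ^ 2) +
        2 * τ * (π i * ⟪v i - ∑ t, F' t y, z - q⟫)) := sum_congr rfl fun i _ => by ring
    _ = ‖y - z‖ ^ 2 + 2 * τ ^ 2 * ∑ i, π i * ‖v i - ∑ t, F' t y‖ ^ 2 := by
        rw [sum_add_distrib, sum_add_distrib, ← sum_mul, ← mul_sum, ← mul_sum, hmean, hπsum]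
        ring
    _ ≤ _ := by nlinarith [mul_le_mul_of_nonneg_left hvar (by positivity : 0 ≤ 2 * τ ^ 2)]

end FiniteSum

section Draws

variable {N : ℕ} {π : Fin (N + 1) → ℝ}

/-- The expectation of `Φ` over the first `M` independent draws with distribution `π`. -/
def drawExpectation (π : Fin (N + 1) → ℝ) (M : ℕ) (Φ : (ℕ → Fin (N + 1)) → ℝ) : ℝ :=
  ∑ v : Fin M → Fin (N + 1), (∏ j, π (v j)) * Φ (extendIdx M v)

lemma extendIdx_snoc (M : ℕ) (v : Fin M → Fin (N + 1)) (i : Fin (N + 1)) :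
    extendIdx (M + 1) (Fin.snoc v i : Fin (M + 1) → Fin (N + 1)) =
      Function.update (extendIdx M v) M i := by
  funext j
  rcases lt_trichotomy j M with h | rfl | h
  · simp [extendIdx, Fin.snoc, h, h.ne, h.trans M.lt_succ_self]
  · simp [extendIdx, Fin.snoc]
  · simp [extendIdx, h.ne', not_lt.2 h.le, not_lt.2 (Nat.succ_le_of_lt h)]

lemma drawExpectation_succ (M : ℕ) (Φ : (ℕ → Fin (N + 1)) → ℝ) :
    drawExpectation π (M + 1) Φ =
      drawExpectation π M (fun idx => ∑ i, π i * Φ (Function.update idx M i)) := by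
  unfold drawExpectation
  rw [← (Fin.snocEquiv fun _ : Fin (M + 1) => Fin (N + 1)).sum_comp, Fintype.sum_prod_type_right]
  refine sum_congr rfl fun v _ => ?_
  rw [mul_sum]
  refine sum_congr rfl fun i _ => ?_
  have e : Fin.snocEquiv (fun _ : Fin (M + 1) => Fin (N + 1)) (i, v) =
      (Fin.snoc v i : Fin (M + 1) → Fin (N + 1)) := rfl
  rw [e, extendIdx_snoc, Fin.prod_univ_castSucc]
  simp only [Fin.snoc_castSucc, Fin.snoc_last]
  ring

lemma drawExpectation_mono (hπ : ∀ t, 0 < π t) (M : ℕ) {Φ Ψ : (ℕ → Fin (N + 1)) → ℝ}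
    (h : ∀ idx, Φ idx ≤ Ψ idx) : drawExpectation π M Φ ≤ drawExpectation π M Ψ :=
  sum_le_sum fun v _ => mul_le_mul_of_nonneg_left (h _) (prod_nonneg fun j _ => (hπ (v j)).le)

lemma drawExpectation_const_mul (M : ℕ) (c : ℝ) (Φ : (ℕ → Fin (N + 1)) → ℝ) :
    drawExpectation π M (fun idx => c * Φ idx) = c * drawExpectation π M Φ := by
  unfold drawExpectation
  rw [mul_sum]
  exact sum_congr rfl fun v _ => by ring

lemma drawExpectation_sub_const (hπsum : ∑ t, π t = 1) (M : ℕ) (c : ℝ)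
    (Φ : (ℕ → Fin (N + 1)) → ℝ) :
    drawExpectation π M (fun idx => Φ idx - c) = drawExpectation π M Φ - c := by
  have h : ∑ v : Fin M → Fin (N + 1), ∏ j, π (v j) = 1 := by
    rw [← Fintype.sum_pow, hπsum, one_pow]
  unfold drawExpectation
  simp_rw [mul_sub]
  rw [sum_sub_distrib, ← sum_mul, h, one_mul]

lemma drawExpectation_le_of_supermartingale (hπ : ∀ t, 0 < π t) (M : ℕ)
    {Ψ : ℕ → (ℕ → Fin (N + 1)) → ℝ}
    (h : ∀ k idx, ∑ i, π i * Ψ (k + 1) (Function.update idx (M + k) i) ≤ Ψ k idx) (k : ℕ) :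
    drawExpectation π (M + k) (Ψ k) ≤ drawExpectation π M (Ψ 0) := by
  induction k with
  | zero => simp
  | succ k ih =>
    rw [← add_assoc, drawExpectation_succ]
    exact (drawExpectation_mono hπ _ (h k)).trans ih

end Draws

section Iterates

variable {n N : ℕ} {F' : Fin (N + 1) → EuclideanSpace ℝ (Fin n) → EuclideanSpace ℝ (Fin n)}
  {π : Fin (N + 1) → ℝ} {prox : EuclideanSpace ℝ (Fin n) → EuclideanSpace ℝ (Fin n)} {τ : ℝ}

lemma svrgInner_congr {idx idx' : ℕ → Fin (N + 1)} {w : EuclideanSpace ℝ (Fin n)} {k : ℕ}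
    (h : ∀ j < k, idx j = idx' j) :
    svrgInner F' π prox τ idx w k = svrgInner F' π prox τ idx' w k := by
  induction k with
  | zero => rfl
  | succ k ih =>
    simp only [svrgInner]
    rw [ih fun j hj => h j (hj.trans k.lt_succ_self), h k k.lt_succ_self]

lemma svrgOuter_congr {idx idx' : ℕ → Fin (N + 1)} {T : ℕ} {y : EuclideanSpace ℝ (Fin n)} {s : ℕ}
    (h : ∀ j < s * T, idx j = idx' j) :
    svrgOuter F' π prox τ idx T y s = svrgOuter F' π prox τ idx' T y s := by
  induction s with
  | zero => rfl
  | succ s ih =>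
    have hle : s * T + T = (s + 1) * T := by ring
    simp only [svrgOuter]
    rw [ih fun j hj => h j (by omega)]
    congr 1
    refine sum_congr rfl fun k hk => svrgInner_congr fun j hj => h _ ?_
    have := mem_range.1 hk
    omega

lemma svrgOuter_update_of_le {idx : ℕ → Fin (N + 1)} {T : ℕ} {y : EuclideanSpace ℝ (Fin n)}
    {s m : ℕ} (hm : s * T ≤ m) (i : Fin (N + 1)) :
    svrgOuter F' π prox τ (Function.update idx m i) T y s = svrgOuter F' π prox τ idx T y s :=
  svrgOuter_congr fun _ hj => Function.update_of_ne (hj.trans_le hm).ne _ _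

lemma svrgInner_update_of_le {idx : ℕ → Fin (N + 1)} {w : EuclideanSpace ℝ (Fin n)}
    {M k m : ℕ} (hm : k ≤ m) (i : Fin (N + 1)) :
    svrgInner F' π prox τ (fun j => Function.update idx (M + m) i (M + j)) w k =
      svrgInner F' π prox τ (fun j => idx (M + j)) w k :=
  svrgInner_congr fun _ hj => Function.update_of_ne (by omega) _ _

lemma svrgInner_update_succ {idx : ℕ → Fin (N + 1)} {w : EuclideanSpace ℝ (Fin n)}
    {M k : ℕ} (i : Fin (N + 1)) :
    svrgInner F' π prox τ (fun j => Function.update idx (M + k) i (M + j)) w (k + 1) =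
      prox (svrgInner F' π prox τ (fun j => idx (M + j)) w k - τ • ((∑ t, F' t w) +
        (π i)⁻¹ • (F' i (svrgInner F' π prox τ (fun j => idx (M + j)) w k) - F' i w))) := by
  rw [svrgInner]
  simp only [Function.update_self]
  rw [svrgInner_update_of_le le_rfl]

variable {F : Fin (N + 1) → EuclideanSpace ℝ (Fin n) → ℝ} {L σ : ℝ}
  {G : EuclideanSpace ℝ (Fin n) → ℝ} {z : EuclideanSpace ℝ (Fin n)}

/-- Contraction, up to explicit constants, of the expected optimality gap over one stage. -/
lemma drawExpectation_svrgOuter_succ_le (hL : 0 < L) (hπpos : ∀ t, 0 < π t)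
    (hπsum : ∑ t, π t = 1) (hconv : ∀ t, ConvexOn ℝ Set.univ (F t))
    (hF : ∀ t x, HasGradientAt (F t) (F' t x) x)
    (hlip : ∀ t x y, ‖F' t x - F' t y‖ ≤ L * π t * ‖x - y‖)
    (hσ : 0 < σ) (hsc : StronglyConvexWith σ (fun x => ∑ t, F t x))
    (hG : ConvexOn ℝ Set.univ G)
    (hz : ∀ y, (∑ t, F t z) + G z ≤ (∑ t, F t y) + G y) (hτ : 0 < τ) (hτL : 4 * τ * L < 1)
    (hprox : ∀ x y, (1 / 2) * ‖prox x - x‖ ^ 2 + τ * G (prox x) ≤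
      (1 / 2) * ‖y - x‖ ^ 2 + τ * G y) {T : ℕ} (hT : 1 ≤ T)
    (y0 : EuclideanSpace ℝ (Fin n)) (s : ℕ) :
    2 * τ * (1 - 4 * τ * L) * T * drawExpectation π ((s + 1) * T) (fun idx =>
        (∑ t, F t (svrgOuter F' π prox τ idx T y0 (s + 1))) +
          G (svrgOuter F' π prox τ idx T y0 (s + 1)) - ((∑ t, F t z) + G z)) ≤
      (2 / σ + 8 * τ ^ 2 * L * (T + 1)) * drawExpectation π (s * T) (fun idx =>
        (∑ t, F t (svrgOuter F' π prox τ idx T y0 s)) +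
          G (svrgOuter F' π prox τ idx T y0 s) - ((∑ t, F t z) + G z)) := by
  set δ : EuclideanSpace ℝ (Fin n) → ℝ :=
    fun y => (∑ t, F t y) + G y - ((∑ t, F t z) + G z) with hδ
  change 2 * τ * (1 - 4 * τ * L) * T * drawExpectation π ((s + 1) * T) (fun idx =>
      δ (svrgOuter F' π prox τ idx T y0 (s + 1))) ≤
    (2 / σ + 8 * τ ^ 2 * L * (T + 1)) * drawExpectation π (s * T) (fun idx =>
      δ (svrgOuter F' π prox τ idx T y0 s))
  have hδ0 : ∀ y, 0 ≤ δ y := fun y => sub_nonneg.2 (hz y)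
  have hδconv : ConvexOn ℝ Set.univ δ := by
    simp only [hδ, sub_eq_add_neg]
    exact ((convexOn_univ_sum hconv).add hG).add_const (-((∑ t, F t z) + G z))
  have hT0 : (0 : ℝ) < T := by exact_mod_cast hT
  set W : (ℕ → Fin (N + 1)) → EuclideanSpace ℝ (Fin n) :=
    fun idx => svrgOuter F' π prox τ idx T y0 s with hW
  set Y : ℕ → (ℕ → Fin (N + 1)) → EuclideanSpace ℝ (Fin n) :=
    fun k idx => svrgInner F' π prox τ (fun j => idx (s * T + j)) (W idx) k with hY
  set Ψ : ℕ → (ℕ → Fin (N + 1)) → ℝ := fun k idx =>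
    ‖Y k idx - z‖ ^ 2 + 2 * τ * (1 - 4 * τ * L) * (∑ j ∈ range k, δ (Y (j + 1) idx)) +
      8 * τ ^ 2 * L * δ (Y k idx) + 8 * τ ^ 2 * L * ((T : ℝ) - k) * δ (W idx) with hΨ
  have hW_update : ∀ k idx i, W (Function.update idx (s * T + k) i) = W idx := fun k idx i =>
    svrgOuter_update_of_le (Nat.le_add_right _ _) i
  have hY_update : ∀ k j idx i, j ≤ k → Y j (Function.update idx (s * T + k) i) = Y j idx :=
    fun k j idx i hj => by
      simp only [hY]
      rw [hW_update, svrgInner_update_of_le hj]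
  have hsuper : ∀ k idx, ∑ i, π i * Ψ (k + 1) (Function.update idx (s * T + k) i) ≤ Ψ k idx := by
    intro k idx
    have hstep := sum_mul_svrg_step_le hL hπpos hπsum hconv hF hlip hG hz hτ.le
      (by linarith [mul_pos hτ hL]) hprox (Y k idx) (W idx)
      (p := fun i => Y (k + 1) (Function.update idx (s * T + k) i)) (fun i => by
        simp only [hY]
        rw [hW_update, svrgInner_update_succ])
    set C : ℝ := 2 * τ * (1 - 4 * τ * L) * (∑ j ∈ range k, δ (Y (j + 1) idx)) +
      8 * τ ^ 2 * L * ((T : ℝ) - (k + 1)) * δ (W idx) with hC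
    have hpt : ∀ i, Ψ (k + 1) (Function.update idx (s * T + k) i) =
        (‖Y (k + 1) (Function.update idx (s * T + k) i) - z‖ ^ 2 +
          2 * τ * δ (Y (k + 1) (Function.update idx (s * T + k) i))) + C := fun i => by
      have hsum : ∑ j ∈ range k, δ (Y (j + 1) (Function.update idx (s * T + k) i)) =
          ∑ j ∈ range k, δ (Y (j + 1) idx) := sum_congr rfl fun j hj => by
        rw [hY_update k (j + 1) idx i (mem_range.1 hj)]
      simp only [hΨ, hC]
      rw [sum_range_succ, hsum, hW_update]
      push_cast
      ring
    simp_rw [hpt, mul_add (π _) _ C]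
    rw [sum_add_distrib, ← sum_mul, hπsum, one_mul]
    refine (add_le_add_left hstep C).trans_eq ?_
    simp only [hΨ, hC, hδ]
    ring
  have hfinal : ∀ idx, 2 * τ * (1 - 4 * τ * L) * T * δ (svrgOuter F' π prox τ idx T y0 (s + 1)) ≤
      Ψ T idx := by
    intro idx
    have hJ : δ (svrgOuter F' π prox τ idx T y0 (s + 1)) ≤
        (T : ℝ)⁻¹ * ∑ j ∈ range T, δ (Y (j + 1) idx) := by
      have := hδconv.map_sum_le (t := range T) (w := fun _ => (T : ℝ)⁻¹)
        (p := fun j => Y (j + 1) idx) (fun _ _ => by positivity)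
        (by simp [hT0.ne']) (fun _ _ => Set.mem_univ _)
      simp only [smul_eq_mul] at this
      rw [← smul_sum, ← mul_sum] at this
      exact this
    have hc : 0 ≤ 2 * τ * (1 - 4 * τ * L) := mul_nonneg (by positivity) (by linarith)
    have h1 : 2 * τ * (1 - 4 * τ * L) * T * δ (svrgOuter F' π prox τ idx T y0 (s + 1)) ≤
        2 * τ * (1 - 4 * τ * L) * ∑ j ∈ range T, δ (Y (j + 1) idx) := by
      rw [mul_assoc _ (T : ℝ)]
      refine mul_le_mul_of_nonneg_left ?_ hc
      rwa [← le_inv_mul_iff₀ hT0]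
    have h2 : 0 ≤ 8 * τ ^ 2 * L * δ (Y T idx) := mul_nonneg (by positivity) (hδ0 _)
    simp only [hΨ, sub_self, mul_zero, zero_mul]
    linarith [sq_nonneg ‖Y T idx - z‖]
  have hinit : ∀ idx, Ψ 0 idx ≤ (2 / σ + 8 * τ ^ 2 * L * (T + 1)) * δ (W idx) := by
    intro idx
    have h1 := hsc.norm_sub_sq_le hG hz (W idx)
    have h2 : ‖W idx - z‖ ^ 2 ≤ 2 / σ * δ (W idx) := by
      rw [div_mul_eq_mul_div, le_div_iff₀ hσ]
      simp only [hδ]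
      linarith
    have hY0 : Y 0 idx = W idx := rfl
    simp only [hΨ, hY0, range_zero, sum_empty, Nat.cast_zero]
    linarith
  rw [← drawExpectation_const_mul, ← drawExpectation_const_mul, Nat.succ_mul]
  exact (drawExpectation_mono hπpos _ hfinal).trans
    ((drawExpectation_le_of_supermartingale hπpos _ hsuper T).trans
      (drawExpectation_mono hπpos _ hinit))

end Iterates

/-- **Theorem 1.** Geometric convergence in expectation of Prox-SVRG:
`E[P(ỹ^{s̄})] − P(y*) ≤ ρ^{s̄} (P(ỹ⁰) − P(y*))`, the expectation being the weighted
finite sum over all index sequences. -/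
theorem prox_svrg_geometric_convergence
    {n N : ℕ}
    (F : Fin (N + 1) → EuclideanSpace ℝ (Fin n) → ℝ)
    (F' : Fin (N + 1) → EuclideanSpace ℝ (Fin n) → EuclideanSpace ℝ (Fin n))
    (L : Fin (N + 1) → ℝ)
    (hFconv : ∀ t, ConvexOn ℝ Set.univ (F t))
    (hFdiff : ∀ t x, HasGradientAt (F t) (F' t x) x)
    (hFlip : ∀ t x y, ‖F' t x - F' t y‖ ≤ L t * ‖x - y‖)
    (σF : ℝ) (hσF : 0 < σF)
    (hFsc : StronglyConvexWith σF (fun x => ∑ t, F t x))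
    (G : EuclideanSpace ℝ (Fin n) → ℝ)
    (hGconv : ConvexOn ℝ Set.univ G) (hGcont : Continuous G)
    (ystar : EuclideanSpace ℝ (Fin n))
    (hmin : ∀ y, (∑ t, F t ystar) + G ystar ≤ (∑ t, F t y) + G y)
    (huniq : ∀ y, (∑ t, F t y) + G y = (∑ t, F t ystar) + G ystar → y = ystar)
    (π : Fin (N + 1) → ℝ) (hπpos : ∀ t, 0 < π t) (hπsum : ∑ t, π t = 1)
    (LPi : ℝ) (hLPi : LPi = Finset.univ.sup' Finset.univ_nonempty (fun t => L t / π t))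
    (τ : ℝ) (hτ0 : 0 < τ) (hτ : τ < 1 / (4 * LPi))
    (T : ℕ) (hT : 1 ≤ T)
    (ρ : ℝ)
    (hρdef : ρ = 1 / (τ * σF * T * (1 - 4 * τ * LPi)) +
        4 * τ * LPi * (T + 1) / (T * (1 - 4 * τ * LPi)))
    (hρ : ρ < 1)
    (prox : EuclideanSpace ℝ (Fin n) → EuclideanSpace ℝ (Fin n))
    (hprox : ∀ x y, (1 / 2) * ‖prox x - x‖ ^ 2 + τ * G (prox x) ≤
        (1 / 2) * ‖y - x‖ ^ 2 + τ * G y)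
    (ytilde0 : EuclideanSpace ℝ (Fin n)) (sbar : ℕ) (hsbar : 1 ≤ sbar) :
    (∑ v : Fin (sbar * T) → Fin (N + 1), (∏ j, π (v j)) *
        ((∑ t, F t (svrgOuter F' π prox τ (extendIdx (sbar * T) v) T ytilde0 sbar)) +
          G (svrgOuter F' π prox τ (extendIdx (sbar * T) v) T ytilde0 sbar)))
      - ((∑ t, F t ystar) + G ystar) ≤
    ρ ^ sbar * (((∑ t, F t ytilde0) + G ytilde0) - ((∑ t, F t ystar) + G ystar)) := by
  have hL : 0 < LPi := by
    have := hτ0.trans hτ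
    rw [one_div_pos] at this
    linarith
  have hτL : 4 * τ * LPi < 1 := by
    rw [lt_div_iff₀ (by positivity)] at hτ
    linarith
  have hlip : ∀ t x y, ‖F' t x - F' t y‖ ≤ LPi * π t * ‖x - y‖ := fun t x y => by
    have h1 : L t / π t ≤ LPi := by
      rw [hLPi]
      exact le_sup' (fun t => L t / π t) (mem_univ t)
    rw [div_le_iff₀ (hπpos t)] at h1
    exact (hFlip t x y).trans (mul_le_mul_of_nonneg_right h1 (norm_nonneg _))
  have hT0 : (0 : ℝ) < T := by exact_mod_cast hT
  have h1 : 0 < 1 - 4 * τ * LPi := by linarith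
  have hc : 0 < 2 * τ * (1 - 4 * τ * LPi) * T := by positivity
  have hρ0 : 0 ≤ ρ := by
    rw [hρdef]
    positivity
  have hρc : 2 / σF + 8 * τ ^ 2 * LPi * (T + 1) = 2 * τ * (1 - 4 * τ * LPi) * T * ρ := by
    rw [hρdef]
    generalize 1 - 4 * τ * LPi = c at h1
    field_simp
    ring
  have hstage : ∀ s, drawExpectation π (s * T) (fun idx =>
      (∑ t, F t (svrgOuter F' π prox τ idx T ytilde0 s)) +
        G (svrgOuter F' π prox τ idx T ytilde0 s) - ((∑ t, F t ystar) + G ystar)) ≤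
      ρ ^ s * (((∑ t, F t ytilde0) + G ytilde0) - ((∑ t, F t ystar) + G ystar)) := by
    intro s
    induction s with
    | zero =>
      rw [Nat.zero_mul]
      simp [drawExpectation, svrgOuter]
    | succ s ih =>
      have h2 := drawExpectation_svrgOuter_succ_le hL hπpos hπsum hFconv hFdiff hlip hσF hFsc
        hGconv hmin hτ0 hτL hprox hT ytilde0 s
      rw [hρc, mul_assoc _ ρ] at h2
      refine (le_of_mul_le_mul_left h2 hc).trans ?_
      rw [pow_succ', mul_assoc]
      exact mul_le_mul_of_nonneg_left ih hρ0
  have := hstage sbar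
  rwa [drawExpectation_sub_const hπsum] at this

end
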